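/- arXiv:2602.06538 — 9 statements merged into one kernel-verified Lean document; each statement's English description precedes it below -/
import Mathlib

section
/- For all real numbers a, b with 0 ≤ a ≤ 1/2 and 0 ≤ b ≤ 1/2, there exists a pair of integers (u, v) among (0, 0) and (−1, 0) such that |(a+u)² − 3·(b+v)²| ≤ 1/2. -/
/-- For `(a, b) ∈ [0, 1/2]²`, some `(u, v) ∈ {(0,0), (−1,0)}` satisfies
`|(a+u)² − 3(b+v)²| ≤ 1/2`. -/
theorem covering_sqrt3 (a b : ℝ) (ha0 : 0 ≤ a) (ha : a ≤ 1/2)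
    (hb0 : 0 ≤ b) (hb : b ≤ 1/2) :
    ∃ u v : ℤ, ((u, v) = ((0 : ℤ), (0 : ℤ)) ∨ (u, v) = ((-1 : ℤ), (0 : ℤ))) ∧
      |(a + (u : ℝ)) ^ 2 - 3 * (b + (v : ℝ)) ^ 2| ≤ 1/2 := by
  have hb2 : b ^ 2 ≤ 1 / 4 := by nlinarith
  by_cases h : -(1 / 2) ≤ a ^ 2 - 3 * b ^ 2
  · refine ⟨0, 0, Or.inl rfl, ?_⟩
    push_cast
    rw [add_zero, add_zero, abs_le]
    exact ⟨h, by nlinarith [sq_nonneg b]⟩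
  · refine ⟨-1, 0, Or.inr rfl, ?_⟩
    push_cast
    rw [add_zero, abs_le]
    constructor <;> nlinarith
end

section
/- For all real numbers a, b with 0 ≤ a ≤ 1/2 and 0 ≤ b ≤ 1/2, there exists a pair of integers (u, v) among (0, 0), (1, 0), (−2, −1) such that |(a+u)² − 6·(b+v)²| ≤ 3/4. -/
/-- For `(a, b) ∈ [0, 1/2]²`, some `(u, v) ∈ {(0,0), (1,0), (−2,−1)}` satisfies
`|(a+u)² − 6(b+v)²| ≤ 3/4`. -/
theorem covering_sqrt6 (a b : ℝ) (ha0 : 0 ≤ a) (ha : a ≤ 1/2)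
    (hb0 : 0 ≤ b) (hb : b ≤ 1/2) :
    ∃ u v : ℤ,
      ((u, v) = ((0 : ℤ), (0 : ℤ)) ∨ (u, v) = ((1 : ℤ), (0 : ℤ)) ∨
        (u, v) = ((-2 : ℤ), (-1 : ℤ))) ∧
      |(a + (u : ℝ)) ^ 2 - 6 * (b + (v : ℝ)) ^ 2| ≤ 3/4 := by
  by_cases h_zero : a ^ 2 + 3 / 4 < 6 * b ^ 2
  · by_cases h_one : 6 * b ^ 2 < (a + 1) ^ 2 - 3 / 4
    · refine ⟨-2, -1, by simp, ?_⟩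
      have ha_lower : 1 / 4 < a := by nlinarith
      have hb_lower : 1 / 3 < b := by nlinarith
      push_cast
      rw [abs_le]
      constructor
      · nlinarith
      · -- The line `2 * b = a + 1 / 2` is tangent to both bounding hyperbolas at `(1/2, 1/2)`.
        rcases le_total (2 * b) (a + 1 / 2) with h | h
        · nlinarith [mul_nonneg (sub_nonneg.2 h) (by linarith : 0 ≤ 9 / 2 - a - 2 * b)]
        · nlinarith [mul_nonneg (sub_nonneg.2 h) (by linarith : 0 ≤ 3 / 2 + a + 2 * b)]
    · refine ⟨1, 0, by simp, ?_⟩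
      push_cast
      rw [abs_le]
      constructor <;> nlinarith
  · refine ⟨0, 0, by simp, ?_⟩
    push_cast
    rw [abs_le]
    constructor <;> nlinarith
end

section
/- For all real numbers a, b with 0 ≤ a ≤ 1/2 and 0 ≤ b ≤ 1/2, there exists a pair of integers (u, v) among (0, 0), (1, 0), (−4, 1), (−2, −1) such that |(a+u)² − 7·(b+v)²| ≤ 9/14. -/
/-- If `(a, b)` lies below the band of the translate `(0, 0)` and above the band of `(1, 0)`,
then it lies in the band of `(-2, -1)`. -/
lemma abs_norm_sub_two_sub_one_le {a b : ℝ} (ha0 : 0 ≤ a) (ha : a ≤ 1/2) (hb0 : 0 ≤ b)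
    (hb : b ≤ 1/2) (h₀ : a ^ 2 - 7 * b ^ 2 < -(9/14)) (h₁ : 9/14 < (a + 1) ^ 2 - 7 * b ^ 2) :
    |(a - 2) ^ 2 - 7 * (b - 1) ^ 2| ≤ 9/14 := by
  have hlo : 3 + 4 * a ≤ 14 * b := by
    refine le_of_sq_le_sq ?_ (by positivity)
    nlinarith [mul_nonneg (by linarith : 0 ≤ 1 - 2 * a) (by linarith : 0 ≤ 3 - 2 * a)]
  have hhi : 14 * b ≤ 4 + 6 * a := by
    refine le_of_sq_le_sq ?_ (by positivity)
    nlinarith [sq_nonneg (2 * a - 1)]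
  have hlo' : (14 * (1 - b)) ^ 2 ≤ (11 - 4 * a) ^ 2 :=
    pow_le_pow_left₀ (by linarith) (by linarith) 2
  have hhi' : (10 - 6 * a) ^ 2 ≤ (14 * (1 - b)) ^ 2 :=
    pow_le_pow_left₀ (by linarith) (by linarith) 2
  rw [abs_le]
  constructor
  · nlinarith [mul_nonneg (by linarith : 0 ≤ 1 - 2 * a) (by linarith : 0 ≤ 3 - 2 * a)]
  · nlinarith [sq_nonneg (2 * a - 1)]

/-- If `(a, b)` lies below the band of the translate `(1, 0)`, then it lies in the band of
`(-4, 1)`. -/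
lemma abs_norm_sub_four_add_one_le {a b : ℝ} (ha0 : 0 ≤ a) (hb0 : 0 ≤ b) (hb : b ≤ 1/2)
    (h₁ : (a + 1) ^ 2 - 7 * b ^ 2 < -(9/14)) :
    |(a - 4) ^ 2 - 7 * (b + 1) ^ 2| ≤ 9/14 := by
  have hb_sq : b ^ 2 ≤ (1/2) ^ 2 := pow_le_pow_left₀ hb0 hb 2
  have ha_small : a ≤ 1/10 := by nlinarith
  have hb_large : 121/250 ≤ b := by
    by_contra! h
    nlinarith
  rw [abs_le]
  constructor <;> nlinarith

/-- For `(a, b) ∈ [0, 1/2]²`, some `(u, v) ∈ {(0,0), (1,0), (−4,1), (−2,−1)}`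
satisfies `|(a+u)² − 7(b+v)²| ≤ 9/14`. -/
theorem covering_sqrt7 (a b : ℝ) (ha0 : 0 ≤ a) (ha : a ≤ 1/2)
    (hb0 : 0 ≤ b) (hb : b ≤ 1/2) :
    ∃ u v : ℤ,
      ((u, v) = ((0 : ℤ), (0 : ℤ)) ∨ (u, v) = ((1 : ℤ), (0 : ℤ)) ∨
        (u, v) = ((-4 : ℤ), (1 : ℤ)) ∨ (u, v) = ((-2 : ℤ), (-1 : ℤ))) ∧
      |(a + (u : ℝ)) ^ 2 - 7 * (b + (v : ℝ)) ^ 2| ≤ 9/14 := by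
  rcases le_or_gt (-(9/14)) (a ^ 2 - 7 * b ^ 2) with h₀ | h₀
  · refine ⟨0, 0, by simp, ?_⟩
    push_cast
    rw [add_zero, add_zero, abs_le]
    exact ⟨h₀, by nlinarith⟩
  rcases lt_or_ge ((a + 1) ^ 2 - 7 * b ^ 2) (-(9/14)) with h₁ | h₁
  · refine ⟨-4, 1, by simp, ?_⟩
    push_cast
    exact abs_norm_sub_four_add_one_le ha0 hb0 hb h₁
  rcases le_or_gt ((a + 1) ^ 2 - 7 * b ^ 2) (9/14) with h₂ | h₂
  · refine ⟨1, 0, by simp, ?_⟩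
    push_cast
    rw [add_zero, abs_le]
    exact ⟨h₁, h₂⟩
  · refine ⟨-2, -1, by simp, ?_⟩
    push_cast
    exact abs_norm_sub_two_sub_one_le ha0 ha hb0 hb h₀ h₂
end

section
/- For all real numbers a, b with 0 ≤ a ≤ 1/2 and 0 ≤ b ≤ 1/2, there exists a pair of integers (u, v) among (0, 0), (1, 0), (−2, −1), (−6, −2), (−5, 1), (5, −2), (25, −8) such that |(a+u)² − 11·(b+v)²| ≤ 19/22. -/
/-- The part of the square where the value at `(0, 0)` is too small and the value at `(1, 0)` too
large is covered by the translate by `(-6, -2)`. -/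
lemma abs_le_of_shift_neg_six_neg_two {a b : ℝ} (ha0 : 0 ≤ a) (ha : a ≤ 1 / 2) (hb0 : 0 ≤ b)
    (hb : b ≤ 1 / 2) (h₀ : a ^ 2 - 11 * b ^ 2 < -(19 / 22))
    (h₁ : 19 / 22 < (a + 1) ^ 2 - 11 * b ^ 2) :
    |(a - 6) ^ 2 - 11 * (b - 2) ^ 2| ≤ 19 / 22 := by
  -- the tangent to the hyperbola `11 b² - a² = 19/22` at `(1/2, 7/22)`
  have tangent : 19 + 11 * a ≤ 77 * b := by
    by_contra! h
    nlinarith [mul_nonneg ha0 hb0, sq_nonneg (a - 1 / 2)]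
  have a_lower : 36 / 100 ≤ a := by
    by_contra! h
    nlinarith
  have b_upper : 100 * b ≤ 16 + 40 * a := by
    by_contra! h
    nlinarith
  rw [abs_le]
  constructor <;> nlinarith

/-- Where the value at `(1, 0)` is too small, the value at `(-2, -1)` is not. -/
lemma neg_le_shift_neg_two_neg_one {a b : ℝ} (ha0 : 0 ≤ a) (hb0 : 0 ≤ b)
    (hb : b ≤ 1 / 2) (h₁ : (a + 1) ^ 2 - 11 * b ^ 2 < -(19 / 22)) :
    -(19 / 22) ≤ (a - 2) ^ 2 - 11 * (b - 1) ^ 2 := by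
  have a_upper : a ≤ 38 / 100 := by nlinarith
  have b_lower : 41 / 100 + a / 5 ≤ b := by
    by_contra! h
    nlinarith
  nlinarith

/-- Where the value at `(-2, -1)` is too large, one of the translates by `(-5, 1)`, `(5, -2)`,
`(25, -8)` works. -/
lemma abs_le_of_lt_shift_neg_two_neg_one {a b : ℝ} (ha0 : 0 ≤ a) (ha : a ≤ 1 / 2)
    (hb : b ≤ 1 / 2) (h₂ : 19 / 22 < (a - 2) ^ 2 - 11 * (b - 1) ^ 2) :
    |(a - 5) ^ 2 - 11 * (b + 1) ^ 2| ≤ 19 / 22 ∨ |(a + 5) ^ 2 - 11 * (b - 2) ^ 2| ≤ 19 / 22 ∨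
      |(a + 25) ^ 2 - 11 * (b - 8) ^ 2| ≤ 19 / 22 := by
  have a_upper : a ≤ 1 / 10 := by nlinarith
  have b_lower : 466 / 1000 ≤ b := by nlinarith
  by_cases h₃ : (a - 5) ^ 2 - 11 * (b + 1) ^ 2 ≤ 19 / 22
  · exact .inl (abs_le.2 ⟨by nlinarith, h₃⟩)
  push Not at h₃
  have a_upper' : a ≤ 5 / 100 := by nlinarith
  have b_upper : b ≤ 482 / 1000 := by nlinarith
  by_cases h₄ : -(19 / 22) ≤ (a + 5) ^ 2 - 11 * (b - 2) ^ 2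
  · exact .inr (.inl (abs_le.2 ⟨h₄, by nlinarith⟩))
  push Not at h₄
  have a_upper'' : a ≤ 3 / 1000 := by nlinarith
  have b_upper' : b ≤ 467 / 1000 := by nlinarith
  refine .inr (.inr (abs_le.2 ⟨by nlinarith, by nlinarith⟩))

/-- For `(a, b) ∈ [0, 1/2]²`, some
`(u, v) ∈ {(0,0), (1,0), (−2,−1), (−6,−2), (−5,1), (5,−2), (25,−8)}`
satisfies `|(a+u)² − 11(b+v)²| ≤ 19/22`. -/
theorem covering_sqrt11 (a b : ℝ) (ha0 : 0 ≤ a) (ha : a ≤ 1/2)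
    (hb0 : 0 ≤ b) (hb : b ≤ 1/2) :
    ∃ u v : ℤ,
      ((u, v) = ((0 : ℤ), (0 : ℤ)) ∨ (u, v) = ((1 : ℤ), (0 : ℤ)) ∨
        (u, v) = ((-2 : ℤ), (-1 : ℤ)) ∨ (u, v) = ((-6 : ℤ), (-2 : ℤ)) ∨
        (u, v) = ((-5 : ℤ), (1 : ℤ)) ∨ (u, v) = ((5 : ℤ), (-2 : ℤ)) ∨
        (u, v) = ((25 : ℤ), (-8 : ℤ))) ∧
      |(a + (u : ℝ)) ^ 2 - 11 * (b + (v : ℝ)) ^ 2| ≤ 19/22 := by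
  by_cases h₀ : -(19 / 22) ≤ a ^ 2 - 11 * b ^ 2
  · refine ⟨0, 0, by simp, abs_le.2 ⟨?_, ?_⟩⟩ <;> push_cast <;> nlinarith
  push Not at h₀
  rcases lt_or_ge (19 / 22) ((a + 1) ^ 2 - 11 * b ^ 2) with h₁ | h₁
  · exact ⟨-6, -2, by simp, by
      simpa [← sub_eq_add_neg] using abs_le_of_shift_neg_six_neg_two ha0 ha hb0 hb h₀ h₁⟩
  rcases le_or_gt (-(19 / 22)) ((a + 1) ^ 2 - 11 * b ^ 2) with h₁' | h₁'
  · exact ⟨1, 0, by simp, by simpa using abs_le.2 ⟨h₁', h₁⟩⟩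
  rcases le_or_gt ((a - 2) ^ 2 - 11 * (b - 1) ^ 2) (19 / 22) with h₂ | h₂
  · exact ⟨-2, -1, by simp, by
      simpa [← sub_eq_add_neg] using
        abs_le.2 ⟨neg_le_shift_neg_two_neg_one ha0 hb0 hb h₁', h₂⟩⟩
  rcases abs_le_of_lt_shift_neg_two_neg_one ha0 ha hb h₂ with h | h | h
  · exact ⟨-5, 1, by simp, by simpa [← sub_eq_add_neg] using h⟩
  · exact ⟨5, -2, by simp, by simpa [← sub_eq_add_neg] using h⟩
  · exact ⟨25, -8, by simp, by simpa [← sub_eq_add_neg] using h⟩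
end

section
/- For all real numbers a, b with 0 ≤ a ≤ 1/2 and 0 ≤ b ≤ 1/2, there exists a pair of integers (u, v) among (0, 0), (1, 0), (−2, 0), (2, −1), (5, 1), (−7, 1), (−3, −1), (7, −2), (−6, 1), (991, 227), (−19, 4), (−80, 18), (−430, −99), (90, −21) such that |(a+u)² − 19·(b+v)²| ≤ 170/171. -/
/-- The translations available for the covering. -/
def shifts : List (ℤ × ℤ) :=
  [(0, 0), (1, 0), (-2, 0), (2, -1), (5, 1), (-7, 1), (-3, -1), (7, -2), (-6, 1), (991, 227),
    (-19, 4), (-80, 18), (-430, -99), (90, -21)]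

/-- Some translate of `(a, b)` by an element of `shifts` has norm at most `170/171`. -/
def IsCovered (a b : ℝ) : Prop :=
  ∃ w ∈ shifts, |(a + (w.1 : ℝ)) ^ 2 - 19 * (b + (w.2 : ℝ)) ^ 2| ≤ 170 / 171

/-- Integer form of the bound `|(x/N)² - 19 (y/N)²| ≤ 170/171`. -/
def smallNorm (N x y : ℤ) : Bool :=
  Nat.ble (171 * (x * x - 19 * (y * y))).natAbs (170 * (N * N)).natAbs

/-- Integer test that `w` works at the four corners of the cell
`[p/N, (p+1)/N] × [q/N, (q+1)/N]`. -/
def shiftCoversCell (N p q : ℤ) (w : ℤ × ℤ) : Bool :=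
  smallNorm N (p + N * w.1) (q + N * w.2) && smallNorm N (p + N * w.1) (q + N * w.2 + 1) &&
    smallNorm N (p + N * w.1 + 1) (q + N * w.2) && smallNorm N (p + N * w.1 + 1) (q + N * w.2 + 1)

/-- Integer test that the cell lies in a small box around the extremal point `(0, 20/57)`. -/
def cellNearExtremal (N p q : ℤ) : Bool :=
  decide (0 ≤ p) && decide (1000 * (p + 1) ≤ N) &&
    decide (3507 * N ≤ 10000 * q) && decide (1000 * (q + 1) ≤ 351 * N)

/-- Covering test by repeated subdivision of a cell into four, to bounded depth. -/
def cellCovered : ℕ → ℤ → ℤ → ℤ → Bool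
  | 0, _, _, _ => false
  | k + 1, N, p, q =>
    shifts.any (shiftCoversCell N p q) || (cellNearExtremal N p q ||
      (cellCovered k (2 * N) (2 * p) (2 * q) && cellCovered k (2 * N) (2 * p) (2 * q + 1) &&
        cellCovered k (2 * N) (2 * p + 1) (2 * q) && cellCovered k (2 * N) (2 * p + 1) (2 * q + 1)))

theorem abs_le_of_smallNorm {N x y : ℤ} (h : smallNorm N x y = true) :
    171 * |(x : ℝ) ^ 2 - 19 * (y : ℝ) ^ 2| ≤ 170 * (N : ℝ) ^ 2 := by
  rw [smallNorm, Nat.ble_eq, ← Nat.cast_le (α := ℤ), Int.natCast_natAbs, Int.natCast_natAbs,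
    abs_mul, abs_mul, abs_mul_self] at h
  rify at h
  simpa [pow_two] using h

/-- On an interval between consecutive integers, the square lies between its values at the
endpoints, in one order or the other. -/
theorem sq_between_of_mem_Icc_int {x : ℝ} {l : ℤ} (h₁ : (l : ℝ) ≤ x) (h₂ : x ≤ l + 1) :
    (l : ℝ) ^ 2 ≤ x ^ 2 ∧ x ^ 2 ≤ ((l : ℝ) + 1) ^ 2 ∨
      ((l : ℝ) + 1) ^ 2 ≤ x ^ 2 ∧ x ^ 2 ≤ (l : ℝ) ^ 2 := by
  rcases le_or_gt 0 l with hl | hl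
  · have hl' : (0 : ℝ) ≤ l := by exact_mod_cast hl
    exact Or.inl ⟨by nlinarith, by nlinarith⟩
  · have hl' : (l : ℝ) + 1 ≤ 0 := by exact_mod_cast hl
    exact Or.inr ⟨by nlinarith, by nlinarith⟩

theorem isCovered_of_shiftCoversCell {N p q : ℤ} {w : ℤ × ℤ} (hN : 0 < N) (hw : w ∈ shifts)
    (h : shiftCoversCell N p q w = true) {a b : ℝ} (ha : (p : ℝ) ≤ N * a) (ha' : N * a ≤ p + 1)
    (hb : (q : ℝ) ≤ N * b) (hb' : N * b ≤ q + 1) : IsCovered a b := by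
  refine ⟨w, hw, ?_⟩
  simp only [shiftCoversCell, Bool.and_eq_true] at h
  obtain ⟨⟨⟨h₀₀, h₀₁⟩, h₁₀⟩, h₁₁⟩ := h
  have hN' : (0 : ℝ) < N := by exact_mod_cast hN
  have hN2 : (0 : ℝ) < (N : ℝ) ^ 2 := by positivity
  have hx := sq_between_of_mem_Icc_int (x := N * (a + w.1)) (l := p + N * w.1)
    (by push_cast; linarith) (by push_cast; linarith)
  have hy := sq_between_of_mem_Icc_int (x := N * (b + w.2)) (l := q + N * w.2)
    (by push_cast; linarith) (by push_cast; linarith)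
  have k₀₀ := abs_le_of_smallNorm h₀₀
  have k₀₁ := abs_le_of_smallNorm h₀₁
  have k₁₀ := abs_le_of_smallNorm h₁₀
  have k₁₁ := abs_le_of_smallNorm h₁₁
  rw [Int.cast_add _ 1, Int.cast_one] at k₀₁ k₁₀
  rw [Int.cast_add _ 1, Int.cast_add _ 1, Int.cast_one] at k₁₁
  rw [← le_div_iff₀' (by norm_num), abs_le] at k₀₀ k₀₁ k₁₀ k₁₁
  rw [mul_pow] at hx hy
  rw [abs_le]
  constructor <;> refine le_of_mul_le_mul_left ?_ hN2 <;>
    rcases hx with hx | hx <;> rcases hy with hy | hy <;> linarith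

theorem isCovered_near_extremal {a b : ℝ} (ha : 0 ≤ a) (ha' : a ≤ 1 / 1000)
    (hb : 3507 / 10000 ≤ b) (hb' : b ≤ 351 / 1000) : IsCovered a b := by
  rcases le_total (b - 20 / 57) (6 / 25 * a) with h | h
  · refine ⟨(-3, -1), by simp [shifts], ?_⟩
    rw [abs_le]
    push_cast
    constructor <;> nlinarith
  · refine ⟨(991, 227), by simp [shifts], ?_⟩
    rw [abs_le]
    push_cast
    constructor <;> nlinarith

theorem isCovered_of_cellCovered {k : ℕ} {N p q : ℤ} (hN : 0 < N)
    (h : cellCovered k N p q = true) {a b : ℝ} (ha : (p : ℝ) ≤ N * a) (ha' : N * a ≤ p + 1)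
    (hb : (q : ℝ) ≤ N * b) (hb' : N * b ≤ q + 1) : IsCovered a b := by
  induction k generalizing N p q with
  | zero => simp [cellCovered] at h
  | succ k ih =>
    rw [cellCovered, Bool.or_eq_true, Bool.or_eq_true, List.any_eq_true] at h
    rcases h with ⟨w, hw, h⟩ | h | h
    · exact isCovered_of_shiftCoversCell hN hw h ha ha' hb hb'
    · simp only [cellNearExtremal, Bool.and_eq_true, decide_eq_true_eq] at h
      obtain ⟨⟨⟨h₁, h₂⟩, h₃⟩, h₄⟩ := h
      have hN' : (0 : ℝ) < N := by exact_mod_cast hN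
      rify at h₁ h₂ h₃ h₄
      apply isCovered_near_extremal <;> refine le_of_mul_le_mul_left ?_ hN' <;> linarith
    · simp only [Bool.and_eq_true] at h
      obtain ⟨⟨⟨h₀₀, h₀₁⟩, h₁₀⟩, h₁₁⟩ := h
      have hN2 : 0 < 2 * N := by linarith
      rcases le_total (2 * (N * a)) (2 * p + 1) with hp | hp <;>
        rcases le_total (2 * (N * b)) (2 * q + 1) with hq | hq
      · exact ih hN2 h₀₀ (by push_cast; linarith) (by push_cast; linarith)
          (by push_cast; linarith) (by push_cast; linarith)
      · exact ih hN2 h₀₁ (by push_cast; linarith) (by push_cast; linarith)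
          (by push_cast; linarith) (by push_cast; linarith)
      · exact ih hN2 h₁₀ (by push_cast; linarith) (by push_cast; linarith)
          (by push_cast; linarith) (by push_cast; linarith)
      · exact ih hN2 h₁₁ (by push_cast; linarith) (by push_cast; linarith)
          (by push_cast; linarith) (by push_cast; linarith)

theorem cellCovered_half_square : cellCovered 20 2 0 0 = true := by
  decide +kernel

/-- For `(a, b) ∈ [0, 1/2]²`, some `(u, v)` among the fourteen listed pairs
satisfies `|(a+u)² − 19(b+v)²| ≤ 170/171`. -/
theorem covering_sqrt19 (a b : ℝ) (ha0 : 0 ≤ a) (ha : a ≤ 1/2)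
    (hb0 : 0 ≤ b) (hb : b ≤ 1/2) :
    ∃ u v : ℤ,
      ((u, v) = ((0 : ℤ), (0 : ℤ)) ∨ (u, v) = ((1 : ℤ), (0 : ℤ)) ∨
        (u, v) = ((-2 : ℤ), (0 : ℤ)) ∨ (u, v) = ((2 : ℤ), (-1 : ℤ)) ∨
        (u, v) = ((5 : ℤ), (1 : ℤ)) ∨ (u, v) = ((-7 : ℤ), (1 : ℤ)) ∨
        (u, v) = ((-3 : ℤ), (-1 : ℤ)) ∨ (u, v) = ((7 : ℤ), (-2 : ℤ)) ∨
        (u, v) = ((-6 : ℤ), (1 : ℤ)) ∨ (u, v) = ((991 : ℤ), (227 : ℤ)) ∨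
        (u, v) = ((-19 : ℤ), (4 : ℤ)) ∨ (u, v) = ((-80 : ℤ), (18 : ℤ)) ∨
        (u, v) = ((-430 : ℤ), (-99 : ℤ)) ∨ (u, v) = ((90 : ℤ), (-21 : ℤ))) ∧
      |(a + (u : ℝ)) ^ 2 - 19 * (b + (v : ℝ)) ^ 2| ≤ 170/171 := by
  obtain ⟨⟨u, v⟩, hw, h⟩ : IsCovered a b :=
    isCovered_of_cellCovered (by norm_num) cellCovered_half_square (by push_cast; linarith)
      (by push_cast; linarith) (by push_cast; linarith) (by push_cast; linarith)
  exact ⟨u, v, by simpa only [shifts, List.mem_cons, List.not_mem_nil, or_false] using hw, h⟩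
end

section
/- For all rational numbers a, b there exist integers u, v such that |(a − u)² − 6·(b − v)²| ≤ 3/4. Equivalently, the ring ℤ[√6] admits a 3/4-division: for every element ξ = a + b√6 of ℚ(√6) there exists γ = u + v√6 ∈ ℤ[√6] with |N(ξ − γ)| ≤ 3/4, where N(x + y√6) = x² − 6y². -/
/-- Every rational is, up to sign and an integer translation, a point of `[0, 1/2]`. -/
lemma exists_int_add_or_sub_of_mem_Icc_half (a : ℚ) :
    ∃ (n : ℤ) (x : ℚ), 0 ≤ x ∧ x ≤ 1 / 2 ∧ (a = n + x ∨ a = n - x) := by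
  refine ⟨round a, |a - round a|, abs_nonneg _, abs_sub_round a, ?_⟩
  rcases abs_cases (a - round a) with ⟨h, -⟩ | ⟨h, -⟩
  · exact Or.inl (by linarith)
  · exact Or.inr (by linarith)

/-- On the fundamental square `[0, 1/2]²` one of the translates `x + y√6`, `(x - 1) + y√6`,
`(x + 1) + y√6`, `(x + 1) + (y - 1)√6` has norm at most `3/4` in absolute value. -/
lemma exists_abs_norm_sub_le_of_mem_Icc_half {x y : ℚ} (hx₀ : 0 ≤ x) (hx : x ≤ 1 / 2)
    (hy₀ : 0 ≤ y) (hy : y ≤ 1 / 2) :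
    ∃ p q : ℤ, |(x - p) ^ 2 - 6 * (y - q) ^ 2| ≤ 3 / 4 := by
  have hx2 : x ^ 2 ≤ 1 / 4 := by nlinarith
  have hy2 : y ^ 2 ≤ 1 / 4 := by nlinarith
  by_cases h₁ : 6 * y ^ 2 ≤ 3 / 4 + x ^ 2
  · refine ⟨0, 0, abs_le.mpr ⟨?_, ?_⟩⟩ <;> push_cast <;> nlinarith
  by_cases h₂ : 6 * y ^ 2 ≤ 3 / 4 + (1 - x) ^ 2
  · refine ⟨1, 0, abs_le.mpr ⟨?_, ?_⟩⟩ <;> push_cast <;> nlinarith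
  by_cases h₃ : (1 + x) ^ 2 ≤ 6 * y ^ 2 + 3 / 4
  · refine ⟨-1, 0, abs_le.mpr ⟨?_, ?_⟩⟩ <;> push_cast <;> nlinarith
  push Not at h₁ h₂ h₃
  have hx' : 3 / 8 ≤ x := by nlinarith
  have hy' : 2 / 5 ≤ y := by nlinarith
  refine ⟨-1, 1, abs_le.mpr ⟨?_, ?_⟩⟩ <;> push_cast <;> nlinarith

/-- `ℤ[√6]` admits a `3/4`-division: for all rationals `a, b` there are
integers `u, v` with `|(a − u)² − 6(b − v)²| ≤ 3/4`. -/
theorem division_sqrt6 (a b : ℚ) :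
    ∃ u v : ℤ, |(a - (u : ℚ)) ^ 2 - 6 * (b - (v : ℚ)) ^ 2| ≤ 3/4 := by
  obtain ⟨m, x, hx₀, hx, ha⟩ := exists_int_add_or_sub_of_mem_Icc_half a
  obtain ⟨n, y, hy₀, hy, hb⟩ := exists_int_add_or_sub_of_mem_Icc_half b
  obtain ⟨p, q, h⟩ := exists_abs_norm_sub_le_of_mem_Icc_half hx₀ hx hy₀ hy
  have hu : ∃ u : ℤ, (a - u) ^ 2 = (x - p) ^ 2 := by
    rcases ha with rfl | rfl
    · exact ⟨m + p, by push_cast; ring⟩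
    · exact ⟨m - p, by push_cast; ring⟩
  have hv : ∃ v : ℤ, (b - v) ^ 2 = (y - q) ^ 2 := by
    rcases hb with rfl | rfl
    · exact ⟨n + q, by push_cast; ring⟩
    · exact ⟨n - q, by push_cast; ring⟩
  obtain ⟨u, hu⟩ := hu
  obtain ⟨v, hv⟩ := hv
  exact ⟨u, v, by rwa [hu, hv]⟩
end

section
/- For all rational numbers a, b there exist integers u, v such that |(a − u)² − 7·(b − v)²| ≤ 9/14. Equivalently, the ring ℤ[√7] admits a 9/14-division: for every element ξ = a + b√7 of ℚ(√7) there exists γ = u + v√7 ∈ ℤ[√7] with |N(ξ − γ)| ≤ 9/14, where N(x + y√7) = x² − 7y². -/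
/-- The reduced case: both coordinates lie in `[0, 1/2]`, and five translates suffice. -/
lemma exists_abs_norm_sub_le_of_mem_Icc {x y : ℚ} (hx0 : 0 ≤ x) (hx : x ≤ 1 / 2)
    (hy0 : 0 ≤ y) (hy : y ≤ 1 / 2) :
    ∃ u v : ℤ, |(x - u) ^ 2 - 7 * (y - v) ^ 2| ≤ 9 / 14 := by
  by_cases h₀ : 7 * y ^ 2 ≤ 9 / 14 + x ^ 2
  · refine ⟨0, 0, abs_le.2 ⟨?_, ?_⟩⟩ <;> push_cast <;> nlinarith
  by_cases h₁ : 7 * y ^ 2 ≤ 9 / 14 + (1 - x) ^ 2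
  · refine ⟨1, 0, abs_le.2 ⟨?_, ?_⟩⟩ <;> push_cast <;> nlinarith
  by_cases hA : 7 * (1 - y) ^ 2 ≤ 9 / 14 + (1 + x) ^ 2
  · refine ⟨-1, 1, abs_le.2 ⟨?_, ?_⟩⟩ <;> push_cast <;> nlinarith
  push Not at h₀ h₁ hA
  have hline : 5 / 14 + (1 / 2 - x) / 5 ≤ y := by nlinarith
  rcases le_total x (2 / 7) with hx' | hx'
  · refine ⟨4, -1, abs_le.2 ⟨?_, ?_⟩⟩ <;> push_cast <;> nlinarith
  · refine ⟨2, 1, abs_le.2 ⟨?_, ?_⟩⟩ <;> push_cast <;> nlinarith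

/-- Every rational is, up to sign, an integer translate of a point of `[0, 1/2]`. -/
lemma exists_sign_mul_sub_mem_Icc (a : ℚ) :
    ∃ s n : ℤ, s ^ 2 = 1 ∧ 0 ≤ s * (a - n) ∧ s * (a - n) ≤ 1 / 2 := by
  have h := abs_le.1 (abs_sub_round a)
  rcases le_total 0 (a - round a) with h0 | h0
  · exact ⟨1, round a, by norm_num, by simpa using h0, by simpa using h.2⟩
  · exact ⟨-1, round a, by norm_num, by push_cast; linarith, by push_cast; linarith⟩

/-- `ℤ[√7]` admits a `9/14`-division: for all rationals `a, b` there are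
integers `u, v` with `|(a − u)² − 7(b − v)²| ≤ 9/14`. -/
theorem division_sqrt7 (a b : ℚ) :
    ∃ u v : ℤ, |(a - (u : ℚ)) ^ 2 - 7 * (b - (v : ℚ)) ^ 2| ≤ 9/14 := by
  obtain ⟨s, m, hs, hx0, hx⟩ := exists_sign_mul_sub_mem_Icc a
  obtain ⟨t, n, ht, hy0, hy⟩ := exists_sign_mul_sub_mem_Icc b
  obtain ⟨u, v, h⟩ := exists_abs_norm_sub_le_of_mem_Icc hx0 hx hy0 hy
  have reflect (r k w : ℤ) (hr : r ^ 2 = 1) (c : ℚ) :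
      (c - (k + r * w : ℤ)) ^ 2 = (r * (c - k) - w) ^ 2 := by
    have hr' : (r : ℚ) ^ 2 = 1 := by exact_mod_cast hr
    push_cast
    linear_combination (w ^ 2 - (c - k) ^ 2) * hr'
  refine ⟨m + s * u, n + t * v, ?_⟩
  rwa [reflect s m u hs, reflect t n v ht]
end

section
/- For all rational numbers a, b there exist integers u, v such that |(a − u)² − 11·(b − v)²| ≤ 19/22. Equivalently, the ring ℤ[√11] admits a 19/22-division: for every element ξ = a + b√11 of ℚ(√11) there exists γ = u + v√11 ∈ ℤ[√11] with |N(ξ − γ)| ≤ 19/22, where N(x + y√11) = x² − 11y². -/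
/-- The bound on the fundamental domain `[0, 1/2] × [0, 1/2]`. Expanding the norms, each condition
is linear in `a`, `b`, `a ^ 2` and `b ^ 2`. -/
theorem exists_norm_le_of_mem_square {a b : ℚ} (ha : 0 ≤ a) (ha' : a ≤ 1 / 2) (hb : 0 ≤ b)
    (hb' : b ≤ 1 / 2) :
    ∃ u v : ℤ, |(a - (u : ℚ)) ^ 2 - 11 * (b - (v : ℚ)) ^ 2| ≤ 19/22 := by
  by_contra! h
  have h₁ := h 0 0
  have h₂ := h 1 0
  have h₃ := h (-1) 0
  have h₄ := h 2 0
  have h₅ := h 2 1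
  have h₆ := h (-5) 2
  have h₇ := h 6 2
  have h₈ := h 5 (-1)
  have h₉ := h 25 8
  clear h
  push_cast at *
  rw [lt_abs] at *
  have p₁ : a ^ 2 ≤ a / 2 := by nlinarith
  have p₂ : b ^ 2 ≤ b / 2 := by nlinarith
  have p₃ : 0 ≤ a ^ 2 := sq_nonneg a
  have p₄ : 0 ≤ (1 / 2 - a) ^ 2 := sq_nonneg _
  have p₅ : 0 ≤ (1 / 2 - b) ^ 2 := sq_nonneg _
  replace h₁ := h₁.resolve_left fun h => by nlinarith
  replace h₂ := h₂.resolve_left fun h => by nlinarith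
  have b₁ : 7 / 22 < b := by nlinarith
  have p₆ : b ^ 2 ≤ (7 / 22 + 1 / 2) * b - 7 / 44 := by nlinarith
  ring_nf at *
  rcases h₃ with h₃ | h₃ <;> rcases h₄ with h₄ | h₄ <;> try (exfalso; linarith)
  all_goals rcases h₅ with h₅ | h₅ <;> try (exfalso; linarith)
  all_goals rcases h₆ with h₆ | h₆
  all_goals rcases h₇ with h₇ | h₇ <;> try (exfalso; linarith)
  all_goals rcases h₈ with h₈ | h₈ <;> try (exfalso; linarith)
  all_goals rcases h₉ with h₉ | h₉ <;> nlinarith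

/-- To find an integer `u` such that `(a - u) ^ 2` has a given property, one may assume
`0 ≤ a ≤ 1/2`. -/
theorem exists_int_sub_sq_of_forall_mem_Icc (a : ℚ) (P : ℚ → Prop)
    (hP : ∀ x, 0 ≤ x → x ≤ 1 / 2 → ∃ u : ℤ, P ((x - u) ^ 2)) : ∃ u : ℤ, P ((a - u) ^ 2) := by
  obtain ⟨u, hu⟩ := hP _ (abs_nonneg (a - round a)) (abs_sub_round a)
  rcases abs_choice (a - round a) with h | h <;> rw [h] at hu
  · exact ⟨round a + u, by convert hu using 1; push_cast; ring⟩
  · exact ⟨round a - u, by convert hu using 1; push_cast; ring⟩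

/-- `ℤ[√11]` admits a `19/22`-division: for all rationals `a, b` there are
integers `u, v` with `|(a − u)² − 11(b − v)²| ≤ 19/22`. -/
theorem division_sqrt11 (a b : ℚ) :
    ∃ u v : ℤ, |(a - (u : ℚ)) ^ 2 - 11 * (b - (v : ℚ)) ^ 2| ≤ 19/22 := by
  refine exists_int_sub_sq_of_forall_mem_Icc a
    (fun s => ∃ v : ℤ, |s - 11 * (b - (v : ℚ)) ^ 2| ≤ 19/22) fun x hx hx' => ?_
  rw [exists_comm]
  refine exists_int_sub_sq_of_forall_mem_Icc b
    (fun t => ∃ u : ℤ, |(x - (u : ℚ)) ^ 2 - 11 * t| ≤ 19/22) fun y hy hy' => ?_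
  rw [exists_comm]
  exact exists_norm_le_of_mem_square hx hx' hy hy'
end

section
/- For all rational numbers a, b there exist integers u, v such that |(a − u)² − 19·(b − v)²| ≤ 170/171. Equivalently, the ring ℤ[√19] admits a 170/171-division: for every element ξ = a + b√19 of ℚ(√19) there exists γ = u + v√19 ∈ ℤ[√19] with |N(ξ − γ)| ≤ 170/171, where N(x + y√19) = x² − 19y². -/
/-- The denominator of the grid on which rectangles are bisected. It is a multiple of `57` because
the bound `170/171` is attained at `(0, 20/57)`, which has to be a grid point. -/
def gridDenom : ℤ := 114 * 2 ^ 12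

/-- The norm of `X/D + (Y/D)√19 - (u + v√19)`, where `D = gridDenom`, is at most `170/171` in
absolute value. -/
def NormBoundAt (X Y : ℤ) (γ : ℤ × ℤ) : Prop :=
  171 * ((X - gridDenom * γ.1) ^ 2 - 19 * (Y - gridDenom * γ.2) ^ 2).natAbs ≤
    170 * gridDenom.natAbs ^ 2

/-- A sufficient condition, in terms of the corners only, for the norm bound to hold throughout the
rectangle `[X₀/D, X₁/D] × [Y₀/D, Y₁/D]`, where `D = gridDenom`: it holds at the corners, and neither
`x - u` nor `y - v` changes sign on the rectangle. -/
def NormBoundOnBox (X₀ X₁ Y₀ Y₁ : ℤ) (γ : ℤ × ℤ) : Prop :=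
  NormBoundAt X₀ Y₀ γ ∧ NormBoundAt X₁ Y₁ γ ∧ NormBoundAt X₀ Y₁ γ ∧ NormBoundAt X₁ Y₀ γ ∧
  0 ≤ (X₀ - gridDenom * γ.1) * (X₁ - gridDenom * γ.1) ∧
  0 ≤ (Y₀ - gridDenom * γ.2) * (Y₁ - gridDenom * γ.2)

instance (X Y : ℤ) (γ : ℤ × ℤ) : Decidable (NormBoundAt X Y γ) :=
  inferInstanceAs (Decidable (_ ≤ _))

instance (X₀ X₁ Y₀ Y₁ : ℤ) (γ : ℤ × ℤ) : Decidable (NormBoundOnBox X₀ X₁ Y₀ Y₁ γ) :=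
  inferInstanceAs (Decidable (_ ∧ _ ∧ _ ∧ _ ∧ _ ∧ _))

/-- Test, by at most `n` successive bisections of the longer side, whether the rectangle
`[X₀/D, X₁/D] × [Y₀/D, Y₁/D]` splits into rectangles each of which satisfies `NormBoundOnBox` for
some member of `Γ`. -/
def boxCovered (Γ : List (ℤ × ℤ)) : ℕ → ℤ → ℤ → ℤ → ℤ → Bool
  | 0, X₀, X₁, Y₀, Y₁ => Γ.any fun γ => decide (NormBoundOnBox X₀ X₁ Y₀ Y₁ γ)
  | n + 1, X₀, X₁, Y₀, Y₁ =>
    (Γ.any fun γ => decide (NormBoundOnBox X₀ X₁ Y₀ Y₁ γ)) ||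
    if Y₁ - Y₀ < X₁ - X₀ then
      boxCovered Γ n X₀ ((X₀ + X₁) / 2) Y₀ Y₁ && boxCovered Γ n ((X₀ + X₁) / 2) X₁ Y₀ Y₁
    else
      boxCovered Γ n X₀ X₁ Y₀ ((Y₀ + Y₁) / 2) && boxCovered Γ n X₀ X₁ ((Y₀ + Y₁) / 2) Y₁

theorem sq_le_max_sq {p q t : ℚ} (hp : p ≤ t) (hq : t ≤ q) : t ^ 2 ≤ max (p ^ 2) (q ^ 2) := by
  rw [le_max_iff]
  rcases le_total 0 t with h | h
  · right; nlinarith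
  · left; nlinarith

theorem min_sq_le_sq {p q t : ℚ} (hp : p ≤ t) (hq : t ≤ q) (hpq : 0 ≤ p * q) :
    min (p ^ 2) (q ^ 2) ≤ t ^ 2 := by
  rw [min_le_iff]
  rcases le_total 0 p with h | h
  · left; nlinarith
  · rcases le_total q 0 with h' | h'
    · right; nlinarith
    · rcases mul_eq_zero.1 (le_antisymm (mul_nonpos_of_nonpos_of_nonneg h h') hpq) with h0 | h0
      · left; rw [h0]; positivity
      · right; rw [h0]; positivity

theorem abs_sq_sub_le_of_corners {p₀ p₁ q₀ q₁ s t c : ℚ} (hs : s ∈ Set.Icc p₀ p₁)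
    (ht : t ∈ Set.Icc q₀ q₁) (hp : 0 ≤ p₀ * p₁) (hq : 0 ≤ q₀ * q₁)
    (h₀₀ : |p₀ ^ 2 - 19 * q₀ ^ 2| ≤ c) (h₁₁ : |p₁ ^ 2 - 19 * q₁ ^ 2| ≤ c)
    (h₀₁ : |p₀ ^ 2 - 19 * q₁ ^ 2| ≤ c) (h₁₀ : |p₁ ^ 2 - 19 * q₀ ^ 2| ≤ c) :
    |s ^ 2 - 19 * t ^ 2| ≤ c := by
  have hs_max := le_max_iff.1 (sq_le_max_sq hs.1 hs.2)
  have ht_max := le_max_iff.1 (sq_le_max_sq ht.1 ht.2)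
  have hs_min := min_le_iff.1 (min_sq_le_sq hs.1 hs.2 hp)
  have ht_min := min_le_iff.1 (min_sq_le_sq ht.1 ht.2 hq)
  rw [abs_le] at *
  constructor
  · rcases hs_min with h | h <;> rcases ht_max with h' | h' <;> linarith
  · rcases hs_max with h | h <;> rcases ht_min with h' | h' <;> linarith

theorem NormBoundAt.abs_le {X Y : ℤ} {γ : ℤ × ℤ} (h : NormBoundAt X Y γ) :
    |((X : ℚ) / gridDenom - γ.1) ^ 2 - 19 * ((Y : ℚ) / gridDenom - γ.2) ^ 2| ≤ 170 / 171 := by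
  have hD : (0 : ℚ) < gridDenom := by norm_num [gridDenom]
  have key : (171 : ℚ) * |((X : ℚ) - gridDenom * γ.1) ^ 2 - 19 * ((Y : ℚ) - gridDenom * γ.2) ^ 2| ≤
      170 * (gridDenom : ℚ) ^ 2 := by
    have h' : (171 : ℤ) * |(X - gridDenom * γ.1) ^ 2 - 19 * (Y - gridDenom * γ.2) ^ 2| ≤
        170 * |gridDenom| ^ 2 := by
      rw [Int.abs_eq_natAbs, Int.abs_eq_natAbs]
      exact_mod_cast h
    rw [sq_abs] at h'
    exact_mod_cast h'
  have hscale : ((X : ℚ) / gridDenom - γ.1) ^ 2 - 19 * ((Y : ℚ) / gridDenom - γ.2) ^ 2 =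
      (((X : ℚ) - gridDenom * γ.1) ^ 2 - 19 * ((Y : ℚ) - gridDenom * γ.2) ^ 2) /
        (gridDenom : ℚ) ^ 2 := by
    field_simp
  rw [hscale, abs_div, abs_of_pos (pow_pos hD 2), div_le_iff₀ (pow_pos hD 2)]
  linarith

theorem NormBoundOnBox.abs_le {X₀ X₁ Y₀ Y₁ : ℤ} {x y : ℚ} {γ : ℤ × ℤ}
    (h : NormBoundOnBox X₀ X₁ Y₀ Y₁ γ)
    (hx : x ∈ Set.Icc ((X₀ : ℚ) / gridDenom) (X₁ / gridDenom))
    (hy : y ∈ Set.Icc ((Y₀ : ℚ) / gridDenom) (Y₁ / gridDenom)) :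
    |(x - γ.1) ^ 2 - 19 * (y - γ.2) ^ 2| ≤ 170 / 171 := by
  have hsign : ∀ {A B u : ℤ}, 0 ≤ (A - gridDenom * u) * (B - gridDenom * u) →
      0 ≤ ((A : ℚ) / gridDenom - u) * ((B : ℚ) / gridDenom - u) := by
    intro A B u hAB
    have hD : (gridDenom : ℚ) ≠ 0 := by norm_num [gridDenom]
    have hAB' : (0 : ℚ) ≤ (A - gridDenom * u) * (B - gridDenom * u) := by exact_mod_cast hAB
    have heq : ((A : ℚ) / gridDenom - u) * ((B : ℚ) / gridDenom - u) =
        (A - gridDenom * u) * (B - gridDenom * u) / (gridDenom : ℚ) ^ 2 := by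
      field_simp
    rw [heq]
    positivity
  obtain ⟨h₀₀, h₁₁, h₀₁, h₁₀, hu, hv⟩ := h
  exact abs_sq_sub_le_of_corners ⟨sub_le_sub_right hx.1 _, sub_le_sub_right hx.2 _⟩
    ⟨sub_le_sub_right hy.1 _, sub_le_sub_right hy.2 _⟩ (hsign hu) (hsign hv)
    h₀₀.abs_le h₁₁.abs_le h₀₁.abs_le h₁₀.abs_le

theorem exists_abs_le_of_any {Γ : List (ℤ × ℤ)} {X₀ X₁ Y₀ Y₁ : ℤ} {x y : ℚ}
    (h : (Γ.any fun γ => decide (NormBoundOnBox X₀ X₁ Y₀ Y₁ γ)) = true)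
    (hx : x ∈ Set.Icc ((X₀ : ℚ) / gridDenom) (X₁ / gridDenom))
    (hy : y ∈ Set.Icc ((Y₀ : ℚ) / gridDenom) (Y₁ / gridDenom)) :
    ∃ u v : ℤ, |(x - (u : ℚ)) ^ 2 - 19 * (y - (v : ℚ)) ^ 2| ≤ 170 / 171 := by
  obtain ⟨γ, -, hγ⟩ := List.any_eq_true.1 h
  exact ⟨γ.1, γ.2, (of_decide_eq_true hγ).abs_le hx hy⟩

theorem exists_abs_le_of_boxCovered {Γ : List (ℤ × ℤ)} {n : ℕ} {X₀ X₁ Y₀ Y₁ : ℤ} {x y : ℚ}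
    (h : boxCovered Γ n X₀ X₁ Y₀ Y₁ = true)
    (hx : x ∈ Set.Icc ((X₀ : ℚ) / gridDenom) (X₁ / gridDenom))
    (hy : y ∈ Set.Icc ((Y₀ : ℚ) / gridDenom) (Y₁ / gridDenom)) :
    ∃ u v : ℤ, |(x - (u : ℚ)) ^ 2 - 19 * (y - (v : ℚ)) ^ 2| ≤ 170 / 171 := by
  induction n generalizing X₀ X₁ Y₀ Y₁ with
  | zero => exact exists_abs_le_of_any h hx hy
  | succ n ih =>
    rw [boxCovered, Bool.or_eq_true] at h
    rcases h with h | h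
    · exact exists_abs_le_of_any h hx hy
    · split_ifs at h <;> rw [Bool.and_eq_true] at h
      · rcases le_total x (((X₀ + X₁) / 2 : ℤ) / gridDenom) with hm | hm
        · exact ih h.1 ⟨hx.1, hm⟩ hy
        · exact ih h.2 ⟨hm, hx.2⟩ hy
      · rcases le_total y (((Y₀ + Y₁) / 2 : ℤ) / gridDenom) with hm | hm
        · exact ih h.1 hx ⟨hy.1, hm⟩
        · exact ih h.2 hx ⟨hm, hy.2⟩

/-- Lattice points whose norm neighbourhoods cover `[0, 1/2] × [0, 1/2]`. -/
def coveringPoints : List (ℤ × ℤ) :=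
  [(3, 1), (2, 0), (-2, 1), (-1, 0), (-6, -1), (19, -4), (6, -1), (7, 2), (-90, 21), (0, 0),
    (991, -227), (-430, 99)]

/-- The square is cut at `y = 20/57` because the bound is attained at `(0, 20/57)`: this point has
to be a corner of the rectangles that contain it. -/
theorem exists_abs_le_of_mem_Icc {x y : ℚ} (hx : x ∈ Set.Icc 0 (1 / 2))
    (hy : y ∈ Set.Icc 0 (1 / 2)) :
    ∃ u v : ℤ, |(x - (u : ℚ)) ^ 2 - 19 * (y - (v : ℚ)) ^ 2| ≤ 170 / 171 := by
  have hlow : boxCovered coveringPoints 24 0 (57 * 2 ^ 12) 0 (40 * 2 ^ 12) = true := by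
    decide +kernel
  have hhigh : boxCovered coveringPoints 24 0 (57 * 2 ^ 12) (40 * 2 ^ 12) (57 * 2 ^ 12) = true := by
    decide +kernel
  have hx' : x ∈ Set.Icc (((0 : ℤ) : ℚ) / gridDenom) ((57 * 2 ^ 12 : ℤ) / gridDenom) := by
    norm_num [gridDenom] at hx ⊢
    exact hx
  rcases le_total y (20 / 57) with h | h
  · refine exists_abs_le_of_boxCovered hlow hx' ?_
    norm_num [gridDenom] at hy ⊢
    exact ⟨hy.1, h⟩
  · refine exists_abs_le_of_boxCovered hhigh hx' ?_
    norm_num [gridDenom] at hy ⊢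
    exact ⟨h, hy.2⟩

/-- Up to sign, every rational is congruent modulo `1` to a member of `[0, 1/2]`. -/
theorem exists_mem_Icc_sq_sub_int (a : ℚ) :
    ∃ x ∈ Set.Icc (0 : ℚ) (1 / 2), ∀ u : ℤ, ∃ w : ℤ, (a - (w : ℚ)) ^ 2 = (x - (u : ℚ)) ^ 2 := by
  refine ⟨|a - round a|, ⟨abs_nonneg _, abs_sub_round a⟩, fun u => ?_⟩
  rcases abs_choice (a - round a) with h | h <;> rw [h]
  · exact ⟨round a + u, by push_cast; ring⟩
  · exact ⟨round a - u, by push_cast; ring⟩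

/-- `ℤ[√19]` admits a `170/171`-division: for all rationals `a, b` there are
integers `u, v` with `|(a − u)² − 19(b − v)²| ≤ 170/171`. -/
theorem division_sqrt19 (a b : ℚ) :
    ∃ u v : ℤ, |(a - (u : ℚ)) ^ 2 - 19 * (b - (v : ℚ)) ^ 2| ≤ 170/171 := by
  obtain ⟨x, hx, hax⟩ := exists_mem_Icc_sq_sub_int a
  obtain ⟨y, hy, hby⟩ := exists_mem_Icc_sq_sub_int b
  obtain ⟨u, v, huv⟩ := exists_abs_le_of_mem_Icc hx hy
  obtain ⟨u', hu⟩ := hax u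
  obtain ⟨v', hv⟩ := hby v
  exact ⟨u', v', by rwa [hu, hv]⟩
end
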